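/- Let A be a quaternion algebra over ℚ ramified over ℝ, O' an order in A, and I' a nonzero two-sided ideal of O'. Then the Hamilton–Lagrange spectrum Sp_{I'} is a bounded subset of ℝ: there is a constant C > 0 such that c_{I'}(x) ≤ C for every x ∈ A(ℝ) \ A(ℚ). -/

import Mathlib

open scoped Quaternion

namespace Quaternion

/-- The square of the Dieudonné determinant of the quaternionic matrix with columns
`(p₁, q₁)` and `(p₂, q₂)`. -/
noncomputable def matNormSq (p₁ q₁ p₂ q₂ : ℍ[ℝ]) : ℝ :=
  normSq p₁ * normSq q₂ + normSq p₂ * normSq q₁ - 2 * (p₁ * star q₁ * q₂ * star p₂).re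

/-- The entries of the adjugate of the quaternionic matrix with columns `(p₁, q₁)` and `(p₂, q₂)`
are values of this function at permutations of the entries. -/
noncomputable def adjEntry (p₁ q₁ p₂ q₂ : ℍ[ℝ]) : ℍ[ℝ] :=
  normSq q₂ • star p₁ - star q₁ * q₂ * star p₂

theorem matNormSq_swap_columns (p q p' q' : ℍ[ℝ]) :
    matNormSq p' q' p q = matNormSq p q p' q' := by
  have : (p' * star q' * q * star p).re = (p * star q * q' * star p').re := by
    rw [← re_star]; simp only [star_mul, star_star, mul_assoc]
  rw [matNormSq, matNormSq, this]; ring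

theorem adjEntry_mul_add (p q p' q' : ℍ[ℝ]) :
    adjEntry p q p' q' * p + adjEntry q p q' p' * q = (matNormSq p q p' q' : ℍ[ℝ]) := by
  ext <;> simp only [re_coe, imI_coe, imJ_coe, imK_coe] <;>
    simp [matNormSq, adjEntry, normSq_def'] <;> ring

theorem adjEntry_mul_add_eq_zero (p q p' q' : ℍ[ℝ]) :
    adjEntry p q p' q' * p' + adjEntry q p q' p' * q' = 0 := by
  ext <;> simp [adjEntry, normSq_def'] <;> ring

theorem mul_adjEntry_add (p q p' q' : ℍ[ℝ]) :
    p * adjEntry p q p' q' + p' * adjEntry p' q' p q = (matNormSq p q p' q' : ℍ[ℝ]) := by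
  ext <;> simp only [re_coe, imI_coe, imJ_coe, imK_coe] <;>
    simp [matNormSq, adjEntry, normSq_def'] <;> ring

theorem mul_adjEntry_add_eq_zero (p q p' q' : ℍ[ℝ]) :
    q * adjEntry p q p' q' + q' * adjEntry p' q' p q = 0 := by
  ext <;> simp [adjEntry, normSq_def'] <;> ring

theorem matNormSq_swap_rows (p q p' q' : ℍ[ℝ]) :
    matNormSq q p q' p' = matNormSq p q p' q' := by
  simp [matNormSq, normSq_def']; ring

theorem matNormSq_eq {q q' : ℍ[ℝ]} (p p' : ℍ[ℝ]) (hq : q ≠ 0) (hq' : q' ≠ 0) :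
    matNormSq p q p' q' = normSq q * normSq q' * normSq (p * q⁻¹ - p' * q'⁻¹) := by
  obtain ⟨a, rfl⟩ : ∃ a, p = a * q := ⟨p * q⁻¹, by rw [inv_mul_cancel_right₀ hq]⟩
  obtain ⟨a', rfl⟩ : ∃ a', p' = a' * q' := ⟨p' * q'⁻¹, by rw [inv_mul_cancel_right₀ hq']⟩
  rw [mul_inv_cancel_right₀ hq, mul_inv_cancel_right₀ hq', matNormSq]
  have h : a * q * star q * q' * star (a' * q') = (normSq q * normSq q') • (a * star a') := by
    rw [mul_assoc a, self_mul_star, star_mul, ← mul_assoc, mul_assoc _ q', self_mul_star,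
      mul_coe_eq_smul, mul_coe_eq_smul, smul_mul_assoc, smul_mul_assoc, smul_smul, mul_comm (normSq q')]
  rw [h, re_smul, map_mul, map_mul, sub_eq_add_neg a, normSq_add, normSq_neg, star_neg, mul_neg,
    re_neg, smul_eq_mul]
  ring

theorem matNormSq_mobius {p q r s P₁ Q₁ P₂ Q₂ p₁ q₁ p₂ q₂ : ℍ[ℝ]} (hq : q ≠ 0)
    (hQ₁ : Q₁ ≠ 0) (hQ₂ : Q₂ ≠ 0) (hq₁ : q₁ ≠ 0) (hq₂ : q₂ ≠ 0)
    (h₁ : p * P₁ + r * Q₁ = p₁) (h₁' : q * P₁ + s * Q₁ = q₁)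
    (h₂ : p * P₂ + r * Q₂ = p₂) (h₂' : q * P₂ + s * Q₂ = q₂) :
    matNormSq p₁ q₁ p₂ q₂ = normSq (q * r - q * p * q⁻¹ * s) * matNormSq P₁ Q₁ P₂ Q₂ := by
  have key : ∀ {P Q p' q' : ℍ[ℝ]}, Q ≠ 0 → q' ≠ 0 → p * P + r * Q = p' → q * P + s * Q = q' →
      p' * q'⁻¹ = p * q⁻¹ + (r - p * q⁻¹ * s) * (q * (P * Q⁻¹) + s)⁻¹ ∧
        q * (P * Q⁻¹) + s = q' * Q⁻¹ := by
    intro P Q p' q' hQ hq' h h'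
    have hz : q * (P * Q⁻¹) + s = q' * Q⁻¹ := by
      rw [← h', add_mul, mul_inv_cancel_right₀ hQ, mul_assoc]
    refine ⟨?_, hz⟩
    have hp' : p' = p * q⁻¹ * q' + (r - p * q⁻¹ * s) * Q := by
      rw [← h, ← h', mul_add, ← mul_assoc (p * q⁻¹) q P, inv_mul_cancel_right₀ hq]
      noncomm_ring
    rw [hz, mul_inv_rev, inv_inv, ← mul_assoc, hp', add_mul, mul_inv_cancel_right₀ hq']
  obtain ⟨e₁, z₁⟩ := key hQ₁ hq₁ h₁ h₁'
  obtain ⟨e₂, z₂⟩ := key hQ₂ hq₂ h₂ h₂'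
  have hz₁ : q * (P₁ * Q₁⁻¹) + s ≠ 0 := z₁ ▸ mul_ne_zero hq₁ (inv_ne_zero hQ₁)
  have hz₂ : q * (P₂ * Q₂⁻¹) + s ≠ 0 := z₂ ▸ mul_ne_zero hq₂ (inv_ne_zero hQ₂)
  have hω : q * r - q * p * q⁻¹ * s = q * (r - p * q⁻¹ * s) := by noncomm_ring
  rw [matNormSq_eq _ _ hq₁ hq₂, matNormSq_eq _ _ hQ₁ hQ₂, e₁, e₂, add_sub_add_left_eq_sub,
    ← mul_sub, inv_sub_inv' hz₁ hz₂, add_sub_add_right_eq_sub, ← mul_sub, z₁, z₂, hω,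
    ← neg_sub (P₁ * Q₁⁻¹)]
  simp only [map_mul, normSq_inv, normSq_neg]
  have n₁ := normSq_ne_zero.2 hq₁
  have n₂ := normSq_ne_zero.2 hq₂
  field_simp

theorem trace_mulLeft (y : ℍ[ℝ]) :
    LinearMap.trace ℝ ℍ[ℝ] (LinearMap.mulLeft ℝ y) = 4 * y.re := by
  let e : Module.Basis (Fin 4) ℝ ℍ[ℝ] := QuaternionAlgebra.basisOneIJK (-1 : ℝ) 0 (-1)
  rw [LinearMap.trace_eq_matrix_trace ℝ e]
  simp only [Matrix.trace, Matrix.diag, LinearMap.toMatrix_apply, LinearMap.mulLeft_apply,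
    Fin.sum_univ_four]
  have hrepr : ∀ (y : ℍ[ℝ]) i, e.repr y i = ![y.re, y.imI, y.imJ, y.imK] i := fun y i =>
    congrFun (QuaternionAlgebra.coe_basisOneIJK_repr (-1 : ℝ) 0 (-1) y) i
  have hre (i) : (e i).re = if i = 0 then 1 else 0 := by
    simpa [Finsupp.single_apply] using (hrepr (e i) 0).symm
  have hI (i) : (e i).imI = if i = 1 then 1 else 0 := by
    simpa [Finsupp.single_apply] using (hrepr (e i) 1).symm
  have hJ (i) : (e i).imJ = if i = 2 then 1 else 0 := by
    simpa [Finsupp.single_apply] using (hrepr (e i) 2).symm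
  have hK (i) : (e i).imK = if i = 3 then 1 else 0 := by
    simpa [Finsupp.single_apply] using (hrepr (e i) 3).symm
  simp [hrepr, hre, hI, hJ, hK, -QuaternionAlgebra.coe_basisOneIJK_repr]
  ring

end Quaternion

/-- An order is the set of integral points of a real basis of the quaternions. -/
theorem exists_basis_of_order
    (A : Subalgebra ℚ (Quaternion ℝ))
    (hAdim : Module.finrank ℚ A = 4)
    (hAspan : Submodule.span ℝ (A : Set (Quaternion ℝ)) = ⊤)
    (O' : Subring (Quaternion ℝ))
    (hO'A : (O' : Set (Quaternion ℝ)) ⊆ A)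
    (hO'fg : ∃ s : Finset (Quaternion ℝ), ↑s ⊆ (O' : Set (Quaternion ℝ)) ∧
      ∀ x ∈ O', x ∈ Submodule.span ℤ (s : Set (Quaternion ℝ)))
    (hO'span : ∀ x ∈ A, x ∈ Submodule.span ℚ (O' : Set (Quaternion ℝ))) :
    ∃ b : Module.Basis (Fin 4) ℝ (Quaternion ℝ),
      ∀ y, y ∈ O' ↔ ∀ i, ∃ z : ℤ, b.repr y i = z := by
  obtain ⟨s, hs, hsO⟩ := hO'fg
  set L : Submodule ℤ (Quaternion ℝ) := O'.toAddSubgroup.toIntSubmodule with hL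
  have memL : ∀ y, y ∈ L ↔ y ∈ O' := fun y => Iff.rfl
  have hLs : L = Submodule.span ℤ (s : Set (Quaternion ℝ)) :=
    le_antisymm (fun y hy => hsO y hy) (Submodule.span_le.2 fun y hy => hs hy)
  have : Module.Finite ℤ L := Module.Finite.of_fg ⟨s, hLs.symm⟩
  have : IsAddTorsionFree (Quaternion ℝ) := .of_module_rat _
  have : Module.Free ℤ L := Module.free_of_finite_type_torsion_free'
  obtain ⟨n, ⟨c⟩⟩ : ∃ n, Nonempty (Module.Basis (Fin n) ℤ L) := ⟨_, ⟨Module.finBasis ℤ L⟩⟩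
  let v : Fin n → Quaternion ℝ := fun i => c i
  have hvZ : LinearIndependent ℤ v :=
    c.linearIndependent.map' L.subtype (Submodule.ker_subtype L)
  have hvQ : LinearIndependent ℚ v := (LinearIndependent.iff_fractionRing ℤ ℚ).1 hvZ
  have hvspan : Submodule.span ℤ (Set.range v) = L := by
    have := congrArg (Submodule.map L.subtype) c.span_eq
    rw [Submodule.map_span, ← Set.range_comp] at this
    simpa [v, Function.comp_def] using this
  have hQ : Submodule.span ℚ (Set.range v) = Subalgebra.toSubmodule A := by
    apply le_antisymm
    · rw [Submodule.span_le]
      rintro _ ⟨i, rfl⟩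
      exact hO'A (c i).2
    · intro y hy
      refine Submodule.span_le.2 ?_ (hO'span y hy)
      intro w hw
      have : w ∈ Submodule.span ℤ (Set.range v) := by rw [hvspan]; exact hw
      exact Submodule.span_le_restrictScalars ℤ ℚ _ this
  have hcard : n = 4 := by
    have hn := finrank_span_eq_card hvQ
    rw [hQ, Fintype.card_fin] at hn
    exact hn.symm.trans hAdim
  have hR : ⊤ ≤ Submodule.span ℝ (Set.range v) := by
    rw [← hAspan, Submodule.span_le]
    intro y hy
    have : y ∈ Submodule.span ℚ (Set.range v) := hQ ▸ hy
    exact Submodule.span_le_restrictScalars ℚ ℝ _ this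
  subst hcard
  let b₀ := basisOfTopLeSpanOfCardEqFinrank v hR (by simp [Quaternion.finrank_eq_four])
  have hb₀ : ∀ i, b₀ i = v i := fun i => by simp [b₀]
  refine ⟨b₀, fun y => ?_⟩
  have hspan : Submodule.span ℤ (Set.range b₀) = L := by
    rw [← hvspan]
    congr 2; ext i : 1; exact hb₀ i
  rw [← memL, ← hspan, Module.Basis.mem_span_iff_repr_mem]
  simp [eq_comm]

section Order

variable {ι : Type*} {O : Subring (Quaternion ℝ)}
  {b : Module.Basis ι ℝ (Quaternion ℝ)}

theorem basis_mem_order (hO : ∀ y, y ∈ O ↔ ∀ i, ∃ z : ℤ, b.repr y i = z)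
    (i : ι) : b i ∈ O := by
  classical
  rw [hO]
  intro j
  rw [b.repr_self, Finsupp.single_apply]
  split_ifs
  exacts [⟨1, by simp⟩, ⟨0, by simp⟩]

variable [Fintype ι]

theorem exists_int_four_mul_re (hO : ∀ y, y ∈ O ↔ ∀ i, ∃ z : ℤ, b.repr y i = z)
    {y : Quaternion ℝ} (hy : y ∈ O) : ∃ z : ℤ, 4 * y.re = z := by
  classical
  have h : ∀ i, ∃ z : ℤ, b.repr (y * b i) i = z := fun i =>
    (hO _).1 (O.mul_mem hy (basis_mem_order hO i)) i
  choose z hz using h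
  refine ⟨∑ i, z i, ?_⟩
  rw [← Quaternion.trace_mulLeft, LinearMap.trace_eq_matrix_trace ℝ b]
  simp only [Matrix.trace, Matrix.diag, LinearMap.toMatrix_apply, LinearMap.mulLeft_apply, hz,
    Int.cast_sum]

theorem two_mul_star_mem (hO : ∀ y, y ∈ O ↔ ∀ i, ∃ z : ℤ, b.repr y i = z)
    {y : Quaternion ℝ} (hy : y ∈ O) : 2 * star y ∈ O := by
  obtain ⟨z, hz⟩ := exists_int_four_mul_re hO hy
  have : 2 * star y = (z : Quaternion ℝ) - 2 * y := by
    have h : (z : Quaternion ℝ) = 2 * ((2 * y.re : ℝ) : Quaternion ℝ) := by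
      rw [← Quaternion.coe_intCast, ← hz, show (4 * y.re : ℝ) = 2 * (2 * y.re) by ring,
        Quaternion.coe_mul]
      rfl
    rw [h, Quaternion.star_eq_two_re_sub, mul_sub]
  rw [this]
  exact O.sub_mem (intCast_mem O z) (O.mul_mem (ofNat_mem O 2) hy)

theorem exists_int_eight_mul_normSq (hO : ∀ y, y ∈ O ↔ ∀ i, ∃ z : ℤ, b.repr y i = z)
    {y : Quaternion ℝ} (hy : y ∈ O) : ∃ z : ℤ, 8 * Quaternion.normSq y = z := by
  obtain ⟨z, hz⟩ := exists_int_four_mul_re hO (O.mul_mem hy (two_mul_star_mem hO hy))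
  refine ⟨z, ?_⟩
  rw [← hz, Quaternion.normSq_def, ← mul_assoc]
  have : y * 2 * star y = (2 : ℝ) • (y * star y) := by
    rw [two_smul]; noncomm_ring
  rw [this]
  simp
  ring

theorem one_le_eight_mul_normSq (hO : ∀ y, y ∈ O ↔ ∀ i, ∃ z : ℤ, b.repr y i = z)
    {y : Quaternion ℝ} (hy : y ∈ O) (h0 : y ≠ 0) : 1 ≤ 8 * Quaternion.normSq y := by
  obtain ⟨z, hz⟩ := exists_int_eight_mul_normSq hO hy
  have hpos : 0 < 8 * Quaternion.normSq y := by
    have := (Quaternion.normSq_nonneg (a := y)).lt_of_ne' (Quaternion.normSq_ne_zero.2 h0)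
    positivity
  rw [hz] at hpos ⊢
  exact_mod_cast hpos

theorem inv_mem_of_mem_order (hO : ∀ y, y ∈ O ↔ ∀ i, ∃ z : ℤ, b.repr y i = z)
    {A : Subalgebra ℚ (Quaternion ℝ)} (hOA : (O : Set (Quaternion ℝ)) ⊆ A)
    {y : Quaternion ℝ} (hy : y ∈ O) : y⁻¹ ∈ A := by
  obtain ⟨z, hz⟩ := exists_int_eight_mul_normSq hO hy
  have h2 : 2 * star y ∈ A := hOA (two_mul_star_mem hO hy)
  have : y⁻¹ = (4 / z : ℚ) • (2 * star y) := by
    have h1 : (Quaternion.normSq y)⁻¹ = ((8 / z : ℚ) : ℝ) := by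
      push_cast
      rw [← hz, mul_comm, div_mul_cancel_right₀ (by norm_num)]
    rw [Quaternion.instInv]
    show (Quaternion.normSq y)⁻¹ • star y = _
    rw [h1, two_mul, ← two_smul ℚ, smul_smul, Rat.cast_smul_eq_qsmul]
    congr 1
    ring
  rw [this]
  exact A.smul_mem h2 _

theorem exists_dvd_sub_of_coord_eq (hO : ∀ y, y ∈ O ↔ ∀ i, ∃ z : ℤ, b.repr y i = z)
    {D : ℕ} {y y' : Quaternion ℝ} (hy : y ∈ O) (hy' : y' ∈ O)
    (h : ∀ i, ((⌊b.repr y i⌋ : ℤ) : ZMod D) = (⌊b.repr y' i⌋ : ℤ)) :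
    ∃ w ∈ O, y - y' = D * w := by
  choose z hz using (hO y).1 hy
  choose z' hz' using (hO y').1 hy'
  have h' : ∀ i, ∃ k : ℤ, z i - z' i = D * k := fun i => by
    have := h i
    rw [hz, hz', Int.floor_intCast, Int.floor_intCast, eq_comm,
      ZMod.intCast_eq_intCast_iff_dvd_sub] at this
    exact this
  choose k hk using h'
  refine ⟨∑ i, k i • b i, O.sum_mem fun i _ => O.zsmul_mem (basis_mem_order hO i) _, ?_⟩
  apply b.repr.injective
  ext i
  have h1 : (D : Quaternion ℝ) * ∑ i, k i • b i = ∑ i, ((D * k i : ℤ) : ℝ) • b i := by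
    rw [Finset.mul_sum]
    refine Finset.sum_congr rfl fun i _ => ?_
    rw [Int.cast_smul_eq_zsmul, mul_smul, natCast_zsmul, nsmul_eq_mul]
  rw [h1, b.repr_sum_self, map_sub, Finsupp.sub_apply, hz, hz', ← hk]
  push_cast; rfl

theorem finite_order_inter_closedBall (hO : ∀ y, y ∈ O ↔ ∀ i, ∃ z : ℤ, b.repr y i = z) (R : ℝ) :
    {y : Quaternion ℝ | y ∈ O ∧ ‖y‖ ≤ R}.Finite := by
  have h := ZSpan.setFinite_inter b (s := Metric.closedBall 0 R) Metric.isBounded_closedBall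
  refine h.subset fun y hy => ⟨by simpa using hy.2, ?_⟩
  rw [SetLike.mem_coe, Module.Basis.mem_span_iff_repr_mem]
  intro i
  obtain ⟨z, hz⟩ := (hO y).1 hy.1 i
  exact ⟨z, by simp [hz]⟩

/-- Dirichlet's theorem for an order: the constant is uniform in `x`. -/
theorem exists_dirichlet (hO : ∀ y, y ∈ O ↔ ∀ i, ∃ z : ℤ, b.repr y i = z) [Nonempty ι] :
    ∃ C : ℝ, 0 < C ∧ ∀ (x : Quaternion ℝ) (T : ℕ), 0 < T → ∃ p ∈ O, ∃ q ∈ O, q ≠ 0 ∧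
      ‖q‖ ≤ C * T ∧ ‖p - x * q‖ ≤ C / T := by
  classical
  have hC : 0 < ∑ i, ‖b i‖ :=
    Finset.sum_pos (fun i _ => norm_pos_iff.2 (b.ne_zero i)) Finset.univ_nonempty
  refine ⟨∑ i, ‖b i‖, hC, fun x T hT => ?_⟩
  have hT' : (0 : ℝ) < T := by exact_mod_cast hT
  let Q : (ι → Fin (T + 1)) → Quaternion ℝ := fun n => ∑ i, ((n i : ℕ) : ℝ) • b i
  let F : (ι → Fin (T + 1)) → ι → Fin T := fun n i =>
    ⟨⌊Int.fract (b.repr (x * Q n) i) * T⌋₊, by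
      rw [Nat.floor_lt (by have := Int.fract_nonneg (b.repr (x * Q n) i); positivity)]
      exact (mul_lt_iff_lt_one_left hT').2 (Int.fract_lt_one _)⟩
  obtain ⟨n, n', hne, hF⟩ := Fintype.exists_ne_map_eq_of_card_lt F (by
    simp only [Fintype.card_fun, Fintype.card_fin]
    exact Nat.pow_lt_pow_left (Nat.lt_succ_self T) Fintype.card_ne_zero)
  let z : ι → ℤ := fun i => ⌊b.repr (x * Q n) i⌋ - ⌊b.repr (x * Q n') i⌋
  have hQ : Q n - Q n' = ∑ i, (((n i : ℕ) : ℝ) - ((n' i : ℕ) : ℝ)) • b i := by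
    simp only [Q, ← Finset.sum_sub_distrib, sub_smul]
  have hQO : ∀ n, Q n ∈ O := fun n => O.sum_mem fun i _ => by
    rw [Nat.cast_smul_eq_nsmul]; exact O.nsmul_mem (basis_mem_order hO i) _
  have norm_le : ∀ (c : ι → ℝ) (r : ℝ), (∀ i, |c i| ≤ r) → ‖∑ i, c i • b i‖ ≤ (∑ i, ‖b i‖) * r := by
    intro c r hc
    rw [Finset.sum_mul]
    refine (norm_sum_le _ _).trans (Finset.sum_le_sum fun i _ => ?_)
    rw [norm_smul, mul_comm]
    exact mul_le_mul_of_nonneg_left (hc i) (norm_nonneg _)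
  refine ⟨∑ i, z i • b i, O.sum_mem fun i _ => O.zsmul_mem (basis_mem_order hO i) _,
    Q n - Q n', O.sub_mem (hQO n) (hQO n'), ?_, ?_, ?_⟩
  · intro h0
    apply hne
    rw [hQ] at h0
    ext i
    have := Fintype.linearIndependent_iff.1 b.linearIndependent _ h0 i
    exact_mod_cast sub_eq_zero.1 this
  · rw [hQ]
    refine norm_le _ _ fun i => ?_
    have h1 : ((n i : ℕ) : ℝ) ≤ T := by exact_mod_cast Nat.lt_succ_iff.1 (n i).2
    have h2 : ((n' i : ℕ) : ℝ) ≤ T := by exact_mod_cast Nat.lt_succ_iff.1 (n' i).2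
    rw [abs_le]
    constructor <;> linarith [(Nat.cast_nonneg (n i : ℕ) : (0 : ℝ) ≤ _),
      (Nat.cast_nonneg (n' i : ℕ) : (0 : ℝ) ≤ _)]
  · rw [div_eq_mul_inv]
    have h1 : ∑ i, z i • b i - x * (Q n - Q n') =
        ∑ i, (Int.fract (b.repr (x * Q n') i) - Int.fract (b.repr (x * Q n) i)) • b i := by
      conv_lhs => rw [mul_sub, ← b.sum_repr (x * Q n), ← b.sum_repr (x * Q n')]
      rw [← Finset.sum_sub_distrib, ← Finset.sum_sub_distrib]
      refine Finset.sum_congr rfl fun i _ => ?_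
      rw [← Int.cast_smul_eq_zsmul ℝ, ← sub_smul, ← sub_smul]
      congr 1
      simp only [z, Int.fract]
      push_cast
      ring
    rw [h1]
    refine norm_le _ _ fun i => ?_
    have hfi : ⌊Int.fract (b.repr (x * Q n) i) * T⌋₊ = ⌊Int.fract (b.repr (x * Q n') i) * T⌋₊ :=
      congrArg Fin.val (congrFun hF i)
    have e1 := Nat.floor_le (mul_nonneg (Int.fract_nonneg (b.repr (x * Q n) i)) hT'.le)
    have e2 := Nat.floor_le (mul_nonneg (Int.fract_nonneg (b.repr (x * Q n') i)) hT'.le)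
    have e3 := Nat.lt_floor_add_one (Int.fract (b.repr (x * Q n) i) * T)
    have e4 := Nat.lt_floor_add_one (Int.fract (b.repr (x * Q n') i) * T)
    rw [hfi] at e1 e3
    rw [← one_div, le_div_iff₀ hT']
    nth_rewrite 1 [← abs_of_pos hT']
    rw [← abs_mul, sub_mul, abs_le]
    constructor <;> linarith

open Quaternion

theorem exists_int_matNormSq (hO : ∀ y, y ∈ O ↔ ∀ i, ∃ z : ℤ, b.repr y i = z)
    {p q p' q' : Quaternion ℝ} (hp : p ∈ O) (hq : q ∈ O) (hp' : p' ∈ O) (hq' : q' ∈ O) :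
    ∃ z : ℤ, 64 * matNormSq p q p' q' = z := by
  obtain ⟨a, ha⟩ := exists_int_eight_mul_normSq hO hp
  obtain ⟨c, hc⟩ := exists_int_eight_mul_normSq hO hq
  obtain ⟨a', ha'⟩ := exists_int_eight_mul_normSq hO hp'
  obtain ⟨c', hc'⟩ := exists_int_eight_mul_normSq hO hq'
  obtain ⟨e, he⟩ := exists_int_four_mul_re hO (O.mul_mem (O.mul_mem (O.mul_mem hp
    (two_mul_star_mem hO hq)) hq') (two_mul_star_mem hO hp'))
  have h : p * (2 * star q) * q' * (2 * star p') = (4 : ℝ) • (p * star q * q' * star p') := by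
    have h2 : (2 : Quaternion ℝ) = ((2 : ℝ) : Quaternion ℝ) := rfl
    simp only [h2, coe_mul_eq_smul, mul_smul_comm, smul_mul_assoc, smul_smul]
    norm_num
  rw [h, re_smul, smul_eq_mul] at he
  refine ⟨a * c' + a' * c - 8 * e, ?_⟩
  push_cast
  rw [← ha, ← hc, ← ha', ← hc', ← he, matNormSq]
  ring

theorem sixteen_smul_adjEntry_mem (hO : ∀ y, y ∈ O ↔ ∀ i, ∃ z : ℤ, b.repr y i = z)
    {p q p' q' : Quaternion ℝ} (hp : p ∈ O) (hq : q ∈ O) (hp' : p' ∈ O) (hq' : q' ∈ O) :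
    (16 : ℝ) • adjEntry p q p' q' ∈ O := by
  obtain ⟨c', hc'⟩ := exists_int_eight_mul_normSq hO hq'
  have h : (16 : ℝ) • adjEntry p q p' q' =
      c' • (2 * star p) - 4 • ((2 * star q) * q' * (2 * star p')) := by
    have h2 : (2 : Quaternion ℝ) = ((2 : ℝ) : Quaternion ℝ) := rfl
    rw [← Int.cast_smul_eq_zsmul ℝ, ← hc', ← Nat.cast_smul_eq_nsmul ℝ]
    simp only [h2, coe_mul_eq_smul, mul_smul_comm, smul_mul_assoc, smul_smul, adjEntry, smul_sub]
    congr 2 <;> norm_num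
    ring
  rw [h]
  exact O.sub_mem (O.zsmul_mem (two_mul_star_mem hO hp) _) (O.nsmul_mem (O.mul_mem (O.mul_mem
    (two_mul_star_mem hO hq) hq') (two_mul_star_mem hO hp')) _)

theorem mul_inv_smul_adjEntry_mem (hO : ∀ y, y ∈ O ↔ ∀ i, ∃ z : ℤ, b.repr y i = z)
    {p q p' q' : Quaternion ℝ} (hp : p ∈ O) (hq : q ∈ O) (hp' : p' ∈ O) (hq' : q' ∈ O)
    {Δ : ℝ} {ν F : ℕ} (hν : 64 * Δ = ν) (hν0 : ν ≠ 0) (hF : ν ∣ F) :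
    (F : Quaternion ℝ) * (Δ⁻¹ • adjEntry p q p' q') ∈ O := by
  obtain ⟨k, rfl⟩ := hF
  have h : ((ν * k : ℕ) : Quaternion ℝ) * (Δ⁻¹ • adjEntry p q p' q') =
      (4 * k) • ((16 : ℝ) • adjEntry p q p' q') := by
    have hΔ : Δ ≠ 0 := by
      rintro rfl
      exact hν0 (by exact_mod_cast (by simpa using hν.symm : (ν : ℝ) = 0))
    rw [← nsmul_eq_mul, ← Nat.cast_smul_eq_nsmul ℝ, ← Nat.cast_smul_eq_nsmul ℝ, smul_smul,
      smul_smul]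
    congr 1
    push_cast
    rw [← hν]
    field_simp
    ring
  rw [h]
  exact O.nsmul_mem (sixteen_smul_adjEntry_mem hO hp hq hp' hq') _

theorem exists_unimodular_of_congr (hO : ∀ y, y ∈ O ↔ ∀ i, ∃ z : ℤ, b.repr y i = z)
    {m ν F : ℕ} (hν0 : ν ≠ 0) (hF : ν ∣ F) {P₁ Q₁ P₂ Q₂ p₁ q₁ p₂ q₂ : Quaternion ℝ}
    (hP₁ : P₁ ∈ O) (hQ₁ : Q₁ ∈ O) (hP₂ : P₂ ∈ O) (hQ₂ : Q₂ ∈ O)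
    (hQ₁0 : Q₁ ≠ 0) (hQ₂0 : Q₂ ≠ 0) (hq₁0 : q₁ ≠ 0) (hq₂0 : q₂ ≠ 0)
    (hΔ : 64 * matNormSq P₁ Q₁ P₂ Q₂ = ν) (hΔ' : 64 * matNormSq p₁ q₁ p₂ q₂ = ν)
    (hp₁P : ∃ e ∈ O, p₁ - P₁ = (m * F : ℕ) * e) (hq₁Q : ∃ e ∈ O, q₁ - Q₁ = (m * F : ℕ) * e)
    (hp₂P : ∃ e ∈ O, p₂ - P₂ = (m * F : ℕ) * e) (hq₂Q : ∃ e ∈ O, q₂ - Q₂ = (m * F : ℕ) * e)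
    {w₁ w₂ : Quaternion ℝ}
    (hw₁ : w₁ = (matNormSq P₁ Q₁ P₂ Q₂)⁻¹ • adjEntry P₁ Q₁ P₂ Q₂)
    (hw₂ : w₂ = (matNormSq P₁ Q₁ P₂ Q₂)⁻¹ • adjEntry P₂ Q₂ P₁ Q₁) :
    ∃ p q : Quaternion ℝ, p₁ * w₁ + p₂ * w₂ = p ∧ q₁ * w₁ + q₂ * w₂ = q ∧
      (∃ y ∈ O, p = 1 + m * y) ∧ (∃ y ∈ O, q = m * y) ∧
      (q ≠ 0 → ∃ r ∈ O, ∃ s ∈ O,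
        normSq (q * r - q * p * q⁻¹ * s) = 1) := by
  set Δ := matNormSq P₁ Q₁ P₂ Q₂ with hΔdef
  have hΔ0 : Δ ≠ 0 := by
    intro h0
    rw [h0] at hΔ
    exact hν0 (by exact_mod_cast (by simpa using hΔ.symm : (ν : ℝ) = 0))
  obtain ⟨u₁, hu₁⟩ : ∃ u, u = Δ⁻¹ • adjEntry Q₁ P₁ Q₂ P₂ := ⟨_, rfl⟩
  obtain ⟨u₂, hu₂⟩ : ∃ u, u = Δ⁻¹ • adjEntry Q₂ P₂ Q₁ P₁ := ⟨_, rfl⟩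
  have hcol : matNormSq P₂ Q₂ P₁ Q₁ = Δ := matNormSq_swap_columns ..
  have hrow : matNormSq Q₁ P₁ Q₂ P₂ = Δ := matNormSq_swap_rows ..
  -- the matrix with rows `(w₁, u₁)` and `(w₂, u₂)` is a two-sided inverse
  have hone : Δ⁻¹ • (Δ : Quaternion ℝ) = 1 := by
    rw [smul_coe, inv_mul_cancel₀ hΔ0, coe_one]
  have l₁₁ : w₁ * P₁ + u₁ * Q₁ = 1 := by
    rw [hw₁, hu₁, smul_mul_assoc, smul_mul_assoc, ← smul_add, adjEntry_mul_add, ← hΔdef, hone]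
  have l₁₂ : w₁ * P₂ + u₁ * Q₂ = 0 := by
    rw [hw₁, hu₁, smul_mul_assoc, smul_mul_assoc, ← smul_add, adjEntry_mul_add_eq_zero, smul_zero]
  have l₂₁ : w₂ * P₁ + u₂ * Q₁ = 0 := by
    rw [hw₂, hu₂, smul_mul_assoc, smul_mul_assoc, ← smul_add, adjEntry_mul_add_eq_zero, smul_zero]
  have l₂₂ : w₂ * P₂ + u₂ * Q₂ = 1 := by
    rw [hw₂, hu₂, smul_mul_assoc, smul_mul_assoc, ← smul_add, adjEntry_mul_add, hcol, hone]
  have r₁₁ : P₁ * w₁ + P₂ * w₂ = 1 := by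
    rw [hw₁, hw₂, mul_smul_comm, mul_smul_comm, ← smul_add, mul_adjEntry_add, ← hΔdef, hone]
  have r₂₁ : Q₁ * w₁ + Q₂ * w₂ = 0 := by
    rw [hw₁, hw₂, mul_smul_comm, mul_smul_comm, ← smul_add, mul_adjEntry_add_eq_zero, smul_zero]
  have r₁₂ : P₁ * u₁ + P₂ * u₂ = 0 := by
    rw [hu₁, hu₂, mul_smul_comm, mul_smul_comm, ← smul_add, mul_adjEntry_add_eq_zero, smul_zero]
  have r₂₂ : Q₁ * u₁ + Q₂ * u₂ = 1 := by
    rw [hu₁, hu₂, mul_smul_comm, mul_smul_comm, ← smul_add, mul_adjEntry_add, hrow, hone]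
  have iw₁ : F * w₁ ∈ O := hw₁ ▸ mul_inv_smul_adjEntry_mem hO hP₁ hQ₁ hP₂ hQ₂ hΔ hν0 hF
  have iw₂ : F * w₂ ∈ O := hw₂ ▸ mul_inv_smul_adjEntry_mem hO hP₂ hQ₂ hP₁ hQ₁ hΔ hν0 hF
  have iu₁ : F * u₁ ∈ O := hu₁ ▸ mul_inv_smul_adjEntry_mem hO hQ₁ hP₁ hQ₂ hP₂ hΔ hν0 hF
  have iu₂ : F * u₂ ∈ O := hu₂ ▸ mul_inv_smul_adjEntry_mem hO hQ₂ hP₂ hQ₁ hP₁ hΔ hν0 hF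
  -- entries of the product with a congruent matrix
  have key : ∀ {X₁ X₂ x₁ x₂ v₁ v₂ c : Quaternion ℝ}, F * v₁ ∈ O → F * v₂ ∈ O →
      X₁ * v₁ + X₂ * v₂ = c → (∃ e ∈ O, x₁ - X₁ = (m * F : ℕ) * e) →
      (∃ e ∈ O, x₂ - X₂ = (m * F : ℕ) * e) → ∃ y ∈ O, x₁ * v₁ + x₂ * v₂ = c + m * y := by
    rintro X₁ X₂ x₁ x₂ v₁ v₂ c hv₁ hv₂ rfl ⟨e₁, he₁, h₁⟩ ⟨e₂, he₂, h₂⟩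
    refine ⟨e₁ * (F * v₁) + e₂ * (F * v₂), O.add_mem (O.mul_mem he₁ hv₁) (O.mul_mem he₂ hv₂), ?_⟩
    rw [eq_add_of_sub_eq h₁, eq_add_of_sub_eq h₂, ← mul_assoc e₁, ← mul_assoc e₂,
      ← Nat.cast_comm F e₁, ← Nat.cast_comm F e₂]
    push_cast
    noncomm_ring
  obtain ⟨p, hp, ep⟩ := key iw₁ iw₂ r₁₁ hp₁P hp₂P
  obtain ⟨q, hq, eq⟩ := key iw₁ iw₂ r₂₁ hq₁Q hq₂Q
  obtain ⟨r, hr, er⟩ := key iu₁ iu₂ r₁₂ hp₁P hp₂P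
  obtain ⟨s, hs, es⟩ := key iu₁ iu₂ r₂₂ hq₁Q hq₂Q
  rw [zero_add] at eq er
  have hmO : (m : Quaternion ℝ) ∈ O := natCast_mem O m
  refine ⟨_, _, ep, eq, ⟨p, hp, rfl⟩, ⟨q, hq, rfl⟩, fun hq0 => ⟨m * r, O.mul_mem hmO hr, 1 + m * s,
    O.add_mem O.one_mem (O.mul_mem hmO hs), ?_⟩⟩
  have prod₁ : ∀ x₁ x₂ : Quaternion ℝ,
      (x₁ * w₁ + x₂ * w₂) * P₁ + (x₁ * u₁ + x₂ * u₂) * Q₁ = x₁ := fun x₁ x₂ => by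
    calc _ = x₁ * (w₁ * P₁ + u₁ * Q₁) + x₂ * (w₂ * P₁ + u₂ * Q₁) := by noncomm_ring
      _ = x₁ := by rw [l₁₁, l₂₁, mul_one, mul_zero, add_zero]
  have prod₂ : ∀ x₁ x₂ : Quaternion ℝ,
      (x₁ * w₁ + x₂ * w₂) * P₂ + (x₁ * u₁ + x₂ * u₂) * Q₂ = x₂ := fun x₁ x₂ => by
    calc _ = x₁ * (w₁ * P₂ + u₁ * Q₂) + x₂ * (w₂ * P₂ + u₂ * Q₂) := by noncomm_ring
      _ = x₂ := by rw [l₁₂, l₂₂, mul_one, mul_zero, zero_add]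
  have hmul := matNormSq_mobius hq0 hQ₁0 hQ₂0 hq₁0 hq₂0
    (ep ▸ er ▸ prod₁ p₁ p₂) (eq ▸ es ▸ prod₁ q₁ q₂)
    (ep ▸ er ▸ prod₂ p₁ p₂) (eq ▸ es ▸ prod₂ q₁ q₂)
  rw [← hΔdef] at hmul
  have hΔeq : matNormSq p₁ q₁ p₂ q₂ = Δ := by linarith
  rw [hΔeq] at hmul
  exact mul_right_cancel₀ hΔ0 (by rw [one_mul, ← hmul])

/-- The columns of a matrix over the order with bounded determinant can be combined, with bounded
coefficients, into the first column of a unimodular matrix congruent to the identity mod `m`. -/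
theorem exists_unimodular_bound (hO : ∀ y, y ∈ O ↔ ∀ i, ∃ z : ℤ, b.repr y i = z)
    {m : ℕ} (hm : 0 < m) (B : ℕ) :
    ∃ R : ℝ, ∀ p₁ ∈ O, ∀ q₁ ∈ O, ∀ p₂ ∈ O, ∀ q₂ ∈ O, q₁ ≠ 0 → q₂ ≠ 0 →
      0 < matNormSq p₁ q₁ p₂ q₂ → 64 * matNormSq p₁ q₁ p₂ q₂ ≤ B →
      ∃ w₁ w₂ : Quaternion ℝ, ‖w₁‖ + ‖w₂‖ ≤ R ∧
      ∃ p q : Quaternion ℝ, p₁ * w₁ + p₂ * w₂ = p ∧ q₁ * w₁ + q₂ * w₂ = q ∧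
      (∃ y ∈ O, p = 1 + m * y) ∧ (∃ y ∈ O, q = m * y) ∧
        (q ≠ 0 → ∃ r ∈ O, ∃ s ∈ O,
          normSq (q * r - q * p * q⁻¹ * s) = 1) := by
  classical
  let D := m * B.factorial
  have : NeZero D := ⟨(Nat.mul_pos hm B.factorial_pos).ne'⟩
  let S := {v : Fin 4 → Quaternion ℝ // (∀ j, v j ∈ O) ∧ v 1 ≠ 0 ∧ v 3 ≠ 0 ∧
    0 < matNormSq (v 0) (v 1) (v 2) (v 3) ∧ 64 * matNormSq (v 0) (v 1) (v 2) (v 3) ≤ B}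
  let f : S → Fin (B + 1) × (Fin 4 → ι → ZMod D) := fun v =>
    (⟨⌊64 * matNormSq (v.1 0) (v.1 1) (v.1 2) (v.1 3)⌋₊,
      Nat.lt_succ_of_le (Nat.floor_le_of_le v.2.2.2.2.2)⟩, fun j i => (⌊b.repr (v.1 j) i⌋ : ℤ))
  let g : S → ℝ := fun v =>
    ‖(matNormSq (v.1 0) (v.1 1) (v.1 2) (v.1 3))⁻¹ • adjEntry (v.1 0) (v.1 1) (v.1 2) (v.1 3)‖ +
    ‖(matNormSq (v.1 0) (v.1 1) (v.1 2) (v.1 3))⁻¹ • adjEntry (v.1 2) (v.1 3) (v.1 0) (v.1 1)‖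
  obtain ⟨R, hR⟩ : ∃ R : ℝ, ∀ v, ∃ v₀, f v₀ = f v ∧ g v₀ ≤ R := by
    let rep : Set.range f → S := fun t => t.2.choose
    have hrep : ∀ t, f (rep t) = t := fun t => t.2.choose_spec
    obtain ⟨R, hR⟩ := (Set.finite_range (g ∘ rep)).bddAbove
    exact ⟨R, fun v => ⟨rep ⟨f v, v, rfl⟩, hrep _, hR ⟨_, rfl⟩⟩⟩
  refine ⟨R, fun p₁ hp₁ q₁ hq₁ p₂ hp₂ q₂ hq₂ hq₁0 hq₂0 hpos hle => ?_⟩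
  obtain ⟨⟨v₀, hv₀O, h1, h3, hpos₀, hle₀⟩, hf, hg⟩ := hR ⟨![p₁, q₁, p₂, q₂], by
    intro j; fin_cases j <;> simpa, by simpa, by simpa, by simpa using hpos, by simpa using hle⟩
  obtain ⟨z₀, hz₀⟩ := exists_int_matNormSq hO (hv₀O 0) (hv₀O 1) (hv₀O 2) (hv₀O 3)
  obtain ⟨z, hz⟩ := exists_int_matNormSq hO hp₁ hq₁ hp₂ hq₂
  have hnat : ∀ {t : ℝ} {z : ℤ}, 0 < t → 64 * t = z → 64 * t = (⌊64 * t⌋₊ : ℕ) := by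
    intro t z ht h
    lift z to ℕ using by
      have : (0 : ℝ) ≤ z := by rw [← h]; positivity
      exact_mod_cast this
    rw [h, Int.cast_natCast, Nat.floor_natCast]
  have hf1 : ⌊64 * matNormSq (v₀ 0) (v₀ 1) (v₀ 2) (v₀ 3)⌋₊ = ⌊64 * matNormSq p₁ q₁ p₂ q₂⌋₊ :=
    congrArg (fun t => (t.1 : ℕ)) hf
  have hf2 : ∀ j i, ((⌊b.repr (v₀ j) i⌋ : ℤ) : ZMod D) =
      (⌊b.repr (![p₁, q₁, p₂, q₂] j) i⌋ : ℤ) := fun j i =>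
    congrFun (congrFun (congrArg Prod.snd hf) j) i
  have e := hnat hpos hz
  have e₀ := hnat hpos₀ hz₀
  have hν0 : ⌊64 * matNormSq p₁ q₁ p₂ q₂⌋₊ ≠ 0 := by
    intro h0
    rw [h0] at e
    push_cast at e
    linarith
  refine ⟨_, _, hg, exists_unimodular_of_congr hO hν0
    (Nat.dvd_factorial (Nat.pos_of_ne_zero hν0) (Nat.floor_le_of_le hle))
    (hv₀O 0) (hv₀O 1) (hv₀O 2) (hv₀O 3) h1 h3 hq₁0 hq₂0 (by rw [← hf1]; exact e₀) e
    (exists_dvd_sub_of_coord_eq hO hp₁ (hv₀O 0) fun i => (hf2 0 i).symm)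
    (exists_dvd_sub_of_coord_eq hO hq₁ (hv₀O 1) fun i => (hf2 1 i).symm)
    (exists_dvd_sub_of_coord_eq hO hp₂ (hv₀O 2) fun i => (hf2 2 i).symm)
    (exists_dvd_sub_of_coord_eq hO hq₂ (hv₀O 3) fun i => (hf2 3 i).symm) rfl rfl⟩

theorem norm_sub_mul_inv_mul (x p : Quaternion ℝ) {q : Quaternion ℝ} (hq : q ≠ 0) :
    ‖x - p * q⁻¹‖ * ‖q‖ = ‖p - x * q‖ := by
  rw [← norm_mul, sub_mul, inv_mul_cancel_right₀ hq, norm_sub_rev]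

theorem exists_consecutive_ne (hO : ∀ y, y ∈ O ↔ ∀ i, ∃ z : ℤ, b.repr y i = z)
    {A : Subalgebra ℚ (Quaternion ℝ)} (hOA : (O : Set (Quaternion ℝ)) ⊆ A)
    {x : Quaternion ℝ} (hx : x ∉ A) {C : ℝ} {P Q : ℕ → Quaternion ℝ}
    (hP : ∀ T, P T ∈ O) (hQ : ∀ T, Q T ∈ O) (hQ0 : ∀ T, Q T ≠ 0)
    (hPQ : ∀ T, ‖P T - x * Q T‖ ≤ C / (T + 1 : ℕ)) (M : ℕ) :
    ∃ T ≥ M, P T * (Q T)⁻¹ ≠ P (T + 1) * (Q (T + 1))⁻¹ := by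
  by_contra! hcon
  have hconst : ∀ T ≥ M, P T * (Q T)⁻¹ = P M * (Q M)⁻¹ := fun T hT => by
    induction T, hT using Nat.le_induction with
    | base => rfl
    | succ T hT ih => rw [← hcon T hT, ih]
  have hmem : P M * (Q M)⁻¹ ∈ A := A.mul_mem (hOA (hP M)) (inv_mem_of_mem_order hO hOA (hQ M))
  have hne : x - P M * (Q M)⁻¹ ≠ 0 := fun h => hx (sub_eq_zero.1 h ▸ hmem)
  have hd := norm_pos_iff.2 hne
  obtain ⟨n, hn⟩ := exists_nat_gt (3 * C / ‖x - P M * (Q M)⁻¹‖)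
  have h1 := norm_sub_mul_inv_mul x (P (n + M)) (hQ0 (n + M))
  rw [hconst (n + M) (Nat.le_add_left M n)] at h1
  have h2 := hPQ (n + M)
  have h3 : 1 / 3 ≤ ‖Q (n + M)‖ := by
    have := one_le_eight_mul_normSq hO (hQ (n + M)) (hQ0 (n + M))
    rw [normSq_eq_norm_mul_self] at this
    nlinarith [norm_nonneg (Q (n + M))]
  rw [← h1, le_div_iff₀ (by positivity)] at h2
  rw [div_lt_iff₀ hd] at hn
  push_cast at h2
  have h4 : ‖x - P M * (Q M)⁻¹‖ * (1 / 3) * n ≤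
      ‖x - P M * (Q M)⁻¹‖ * ‖Q (n + M)‖ * (n + M + 1) := by
    gcongr
    linarith [(Nat.cast_nonneg M : (0 : ℝ) ≤ M)]
  linarith

theorem matNormSq_le_of_approx {x p q p' q' : Quaternion ℝ} (hq : q ≠ 0) (hq' : q' ≠ 0)
    {C T : ℝ} (hT : 0 < T) (hqT : ‖q‖ ≤ 2 * C * T) (hq'T : ‖q'‖ ≤ 2 * C * T)
    (h : ‖p - x * q‖ ≤ C / T) (h' : ‖p' - x * q'‖ ≤ C / T) :
    matNormSq p q p' q' ≤ (4 * C ^ 2) ^ 2 := by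
  have hC : 0 ≤ C / T := (norm_nonneg _).trans h
  have key : ‖q‖ * ‖q'‖ * ‖p * q⁻¹ - p' * q'⁻¹‖ ≤ 4 * C ^ 2 := by
    calc ‖q‖ * ‖q'‖ * ‖p * q⁻¹ - p' * q'⁻¹‖
        = ‖q‖ * ‖q'‖ * ‖(x - p' * q'⁻¹) - (x - p * q⁻¹)‖ := by rw [sub_sub_sub_cancel_left]
      _ ≤ ‖q‖ * ‖q'‖ * (‖x - p' * q'⁻¹‖ + ‖x - p * q⁻¹‖) := by gcongr; exact norm_sub_le _ _
      _ = ‖q‖ * (‖x - p' * q'⁻¹‖ * ‖q'‖) + ‖q'‖ * (‖x - p * q⁻¹‖ * ‖q‖) := by ring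
      _ ≤ (2 * C * T) * (C / T) + (2 * C * T) * (C / T) := by
        rw [norm_sub_mul_inv_mul x p hq, norm_sub_mul_inv_mul x p' hq']
        have := (norm_nonneg _).trans hqT
        gcongr
      _ = 4 * C ^ 2 := by field_simp; ring
  rw [matNormSq_eq _ _ hq hq']
  calc _ = (‖q‖ * ‖q'‖ * ‖p * q⁻¹ - p' * q'⁻¹‖) ^ 2 := by
        simp only [normSq_eq_norm_mul_self]; ring
    _ ≤ _ := by gcongr

theorem norm_mul_add_mul_le {a a' w w' : Quaternion ℝ} {r R : ℝ} (h : ‖a‖ ≤ r) (h' : ‖a'‖ ≤ r)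
    (hw : ‖w‖ + ‖w'‖ ≤ R) : ‖a * w + a' * w'‖ ≤ r * R := by
  have hr := (norm_nonneg _).trans h
  calc ‖a * w + a' * w'‖ ≤ ‖a‖ * ‖w‖ + ‖a'‖ * ‖w'‖ := by
        rw [← norm_mul, ← norm_mul]; exact norm_add_le _ _
    _ ≤ r * ‖w‖ + r * ‖w'‖ := by gcongr
    _ = r * (‖w‖ + ‖w'‖) := by ring
    _ ≤ r * R := by gcongr

/-- Approximations of `x` with small error have large denominators. -/
theorem exists_lt_norm_of_norm_sub_le (hO : ∀ y, y ∈ O ↔ ∀ i, ∃ z : ℤ, b.repr y i = z)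
    (x : Quaternion ℝ) (K c : ℝ) (hc : 0 ≤ c) :
    ∃ M : ℕ, ∀ T : ℕ, M ≤ T → ∀ p ∈ O, ∀ q ∈ O, p - x * q ≠ 0 →
      ‖p - x * q‖ ≤ c / (T + 1 : ℕ) → K < ‖q‖ := by
  let Z : Set (Quaternion ℝ × Quaternion ℝ) :=
    {y | y ∈ O ∧ ‖y‖ ≤ c + ‖x‖ * K} ×ˢ {y | y ∈ O ∧ ‖y‖ ≤ K}
  have hZ : Z.Finite := (finite_order_inter_closedBall hO _).prod (finite_order_inter_closedBall hO _)
  obtain ⟨Y, hY⟩ := (hZ.image fun y => ‖y.1 - x * y.2‖⁻¹).bddAbove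
  obtain ⟨M, hM⟩ := exists_nat_gt (Y * c)
  refine ⟨M, fun T hT p hp q hq hne hle => ?_⟩
  by_contra! hqK
  have hT' : (M : ℝ) ≤ T := by exact_mod_cast hT
  have hpc : ‖p‖ ≤ c + ‖x‖ * K := by
    calc ‖p‖ = ‖(p - x * q) + x * q‖ := by rw [sub_add_cancel]
      _ ≤ ‖p - x * q‖ + ‖x‖ * ‖q‖ := by rw [← norm_mul]; exact norm_add_le _ _
      _ ≤ c + ‖x‖ * K := by
        gcongr
        exact hle.trans (div_le_self hc (by push_cast; linarith [(Nat.cast_nonneg T : (0 : ℝ) ≤ T)]))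
  have h1 : ‖p - x * q‖⁻¹ ≤ Y := hY ⟨(p, q), ⟨⟨hp, hpc⟩, ⟨hq, hqK⟩⟩, rfl⟩
  have hpos := norm_pos_iff.2 hne
  rw [inv_le_iff_one_le_mul₀ hpos] at h1
  rw [le_div_iff₀ (by positivity)] at hle
  push_cast at hle
  have hY0 : 0 < Y := pos_of_mul_pos_left (by linarith) hpos.le
  have h2 : Y * (‖p - x * q‖ * (T + 1)) ≤ Y * c := mul_le_mul_of_nonneg_left hle hY0.le
  nlinarith [(Nat.cast_nonneg T : (0 : ℝ) ≤ T)]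

theorem exists_natCast_mem_ideal (hO : ∀ y, y ∈ O ↔ ∀ i, ∃ z : ℤ, b.repr y i = z)
    {I : TwoSidedIdeal O} (hI : I ≠ ⊥) : ∃ m : ℕ, 0 < m ∧ (m : O) ∈ I := by
  obtain ⟨a, haI, ha0⟩ : ∃ a ∈ I, a ≠ 0 := by
    by_contra! h
    exact hI (le_antisymm (fun a ha => by rw [h a ha]; exact TwoSidedIdeal.zero_mem _) bot_le)
  have ha0' : (a : Quaternion ℝ) ≠ 0 := by simpa using ha0
  obtain ⟨z, hz⟩ := exists_int_eight_mul_normSq hO a.2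
  have h1 := one_le_eight_mul_normSq hO a.2 ha0'
  have hz0 : 0 < z := by rw [hz] at h1; exact_mod_cast h1
  lift z to ℕ using hz0.le
  refine ⟨z, by exact_mod_cast hz0, ?_⟩
  have h : (z : O) = a * (4 * ⟨2 * star (a : Quaternion ℝ), two_mul_star_mem hO a.2⟩) := by
    apply Subtype.ext
    have h8 : ((4 : O) : Quaternion ℝ) = 4 := rfl
    push_cast [h8]
    have : (a : Quaternion ℝ) * (4 * (2 * star (a : Quaternion ℝ))) =
        8 * ((a : Quaternion ℝ) * star (a : Quaternion ℝ)) := by noncomm_ring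
    rw [this, self_mul_star]
    have e : ((8 * normSq (a : Quaternion ℝ) : ℝ) : Quaternion ℝ) = ((z : ℝ) : Quaternion ℝ) := by
      rw [hz]; rfl
    rw [coe_mul] at e
    exact e.symm
  rw [h]
  exact I.mul_mem_right _ _ haI

theorem one_add_mul_ne_zero (hO : ∀ y, y ∈ O ↔ ∀ i, ∃ z : ℤ, b.repr y i = z) {m : ℕ} (hm : 4 < m)
    {y : Quaternion ℝ} (hy : y ∈ O) : 1 + m * y ≠ 0 := by
  intro h
  obtain ⟨z, hz⟩ := exists_int_four_mul_re hO hy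
  have h1 := congrArg (fun t : Quaternion ℝ => t.re) h
  rw [← nsmul_eq_mul] at h1
  simp only [re_add, re_one, re_zero, ← Nat.cast_smul_eq_nsmul ℝ, re_smul, smul_eq_mul] at h1
  have h2 : (4 : ℝ) + m * z = 0 := by rw [← hz]; linarith
  have h3 : (4 : ℤ) + m * z = 0 := by exact_mod_cast h2
  have h4 : (m : ℤ) ∣ 4 := ⟨-z, by linarith⟩
  have := Int.le_of_dvd (by norm_num) h4
  omega

theorem exists_unimodular_approx [Nonempty ι] (hO : ∀ y, y ∈ O ↔ ∀ i, ∃ z : ℤ, b.repr y i = z)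
    {A : Subalgebra ℚ (Quaternion ℝ)} (hOA : (O : Set (Quaternion ℝ)) ⊆ A)
    {m : ℕ} (hm : 4 < m) :
    ∃ C : ℝ, 0 < C ∧ ∀ x ∉ A, ∀ K : ℝ, ∃ p ∈ O, ∃ y ∈ O, ∃ q : Quaternion ℝ, q = m * y ∧
      K < ‖q‖ ∧ ‖q‖ * ‖p - x * q‖ ≤ C ∧
      ∃ r ∈ O, ∃ s ∈ O, normSq (q * r - q * p * q⁻¹ * s) = 1 := by
  obtain ⟨C, hC, hdir⟩ := exists_dirichlet hO
  obtain ⟨R, hR⟩ := exists_unimodular_bound hO (by omega : 0 < m) ⌈64 * (4 * C ^ 2) ^ 2⌉₊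
  refine ⟨2 * C ^ 2 * R ^ 2 + 1, by positivity, fun x hx K => ?_⟩
  have hdir' : ∀ T : ℕ, ∃ p ∈ O, ∃ q ∈ O, q ≠ 0 ∧ ‖q‖ ≤ C * (T + 1 : ℕ) ∧
    ‖p - x * q‖ ≤ C / (T + 1 : ℕ) := fun T => hdir x (T + 1) T.succ_pos
  choose P hP Q hQ hQ0 hQC hPQ using hdir'
  obtain ⟨M, hM⟩ := exists_lt_norm_of_norm_sub_le hO x (max K 0) (C * |R|) (by positivity)
  obtain ⟨T, hTM, hne⟩ := exists_consecutive_ne hO hOA hx hP hQ hQ0 hPQ M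
  have hT0 : (0 : ℝ) < (T + 1 : ℕ) := by positivity
  have hT : (0 : ℝ) ≤ T := Nat.cast_nonneg T
  have hQ₁ : ‖Q T‖ ≤ 2 * C * (T + 1 : ℕ) := (hQC T).trans (by nlinarith)
  have hQ₂ : ‖Q (T + 1)‖ ≤ 2 * C * (T + 1 : ℕ) := (hQC (T + 1)).trans (by push_cast; nlinarith)
  have hPQ₂ : ‖P (T + 1) - x * Q (T + 1)‖ ≤ C / (T + 1 : ℕ) :=
    (hPQ (T + 1)).trans (by gcongr; omega)
  have hpos : 0 < matNormSq (P T) (Q T) (P (T + 1)) (Q (T + 1)) := by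
    rw [matNormSq_eq _ _ (hQ0 _) (hQ0 _), ← map_mul, ← map_mul]
    exact normSq_nonneg.lt_of_ne' (normSq_ne_zero.2
      (mul_ne_zero (mul_ne_zero (hQ0 _) (hQ0 _)) (sub_ne_zero.2 hne)))
  have hbd := matNormSq_le_of_approx (hQ0 T) (hQ0 (T + 1)) hT0 hQ₁ hQ₂ (hPQ T) hPQ₂
  obtain ⟨w₁, w₂, hw, p, q, hp, hq, ⟨y, hy, hpy⟩, ⟨y', hy', hqy⟩, hrs⟩ :=
    hR _ (hP T) _ (hQ T) _ (hP (T + 1)) _ (hQ (T + 1)) (hQ0 T) (hQ0 (T + 1)) hpos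
      ((mul_le_mul_of_nonneg_left hbd (by norm_num)).trans (Nat.le_ceil _))
  have hmO : (m : Quaternion ℝ) ∈ O := natCast_mem O m
  have hpO : p ∈ O := hpy ▸ O.add_mem O.one_mem (O.mul_mem hmO hy)
  have hqO : q ∈ O := hqy ▸ O.mul_mem hmO hy'
  have hR0 : 0 ≤ R := le_trans (by positivity) hw
  have hqT : ‖q‖ ≤ 2 * C * (T + 1 : ℕ) * R := hq ▸ norm_mul_add_mul_le hQ₁ hQ₂ hw
  have hpT : ‖p - x * q‖ ≤ C / (T + 1 : ℕ) * R := by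
    have : p - x * q = (P T - x * Q T) * w₁ + (P (T + 1) - x * Q (T + 1)) * w₂ := by
      rw [← hp, ← hq]; noncomm_ring
    exact this ▸ norm_mul_add_mul_le (hPQ T) hPQ₂ hw
  have hne0 : p - x * q ≠ 0 := by
    intro h0
    by_cases hq0 : q = 0
    · rw [hq0, mul_zero, sub_zero, hpy] at h0
      exact one_add_mul_ne_zero hO hm hy h0
    · apply hx
      have : x = p * q⁻¹ := by rw [sub_eq_zero.1 h0, mul_inv_cancel_right₀ hq0]
      rw [this]
      exact A.mul_mem (hOA hpO) (inv_mem_of_mem_order hO hOA hqO)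
  have hlarge := hM T hTM p hpO q hqO hne0 (by rwa [abs_of_nonneg hR0, mul_div_right_comm])
  refine ⟨p, hpO, y', hy', q, hqy, (le_max_left _ _).trans_lt hlarge, ?_,
    hrs (norm_pos_iff.1 ((le_max_right _ _).trans_lt hlarge))⟩
  calc ‖q‖ * ‖p - x * q‖ ≤ (2 * C * (T + 1 : ℕ) * R) * (C / (T + 1 : ℕ) * R) := by gcongr
    _ = 2 * C ^ 2 * R ^ 2 := by field_simp
    _ ≤ _ := by linarith

end Order

/-- The Hamilton–Lagrange spectrum is bounded: there is `C > 0` with `c_{I'}(x) ≤ C`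
for every `x ∈ A(ℝ) \ A(ℚ)`.  Here the quaternion algebra `A` over `ℚ`
ramified over `ℝ` is realized, via a fixed identification `A(ℝ) ≅ ℍ`, as a `ℚ`-subalgebra
of Hamilton's quaternions `ℍ = Quaternion ℝ` of dimension `4` over `ℚ` which spans `ℍ`
over `ℝ`; the reduced norm `N` is `Quaternion.normSq`.  `O'` is an order in `A`
(a subring of `A`, finitely generated as a `ℤ`-module, spanning `A` over `ℚ`),
`I'` is a nonzero two-sided ideal of `O'`,
`E_{I'} = {(p,q) ∈ O' × I' : ∃ r s ∈ O', N(qr - qpq⁻¹s) = 1}`, and for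
`x ∈ ℍ \ A`, `c_{I'}(x) = liminf_{(p,q) ∈ E_{I'}, N(q) → ∞} N(q) √(N(x - pq⁻¹))`. -/
theorem hamilton_lagrange_spectrum_bounded
    (A : Subalgebra ℚ (Quaternion ℝ))
    (hAdim : Module.finrank ℚ A = 4)
    (hAspan : Submodule.span ℝ (A : Set (Quaternion ℝ)) = ⊤)
    (O' : Subring (Quaternion ℝ))
    (hO'A : (O' : Set (Quaternion ℝ)) ⊆ A)
    (hO'fg : ∃ s : Finset (Quaternion ℝ), ↑s ⊆ (O' : Set (Quaternion ℝ)) ∧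
      ∀ x ∈ O', x ∈ Submodule.span ℤ (s : Set (Quaternion ℝ)))
    (hO'span : ∀ x ∈ A, x ∈ Submodule.span ℚ (O' : Set (Quaternion ℝ)))
    (I' : TwoSidedIdeal O') (hI' : I' ≠ ⊥) :
    ∃ C : ℝ, 0 < C ∧ ∀ x : Quaternion ℝ, x ∉ A →
      Filter.liminf
          (fun pq : O' × O' =>
            Quaternion.normSq ((pq.2 : Quaternion ℝ)) *
              Real.sqrt (Quaternion.normSq
                (x - (pq.1 : Quaternion ℝ) * (pq.2 : Quaternion ℝ)⁻¹)))
          (Filter.principal {pq : O' × O' | pq.2 ∈ I' ∧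
              ∃ r s : O', Quaternion.normSq
                ((pq.2 : Quaternion ℝ) * (r : Quaternion ℝ) -
                  (pq.2 : Quaternion ℝ) * (pq.1 : Quaternion ℝ) *
                    (pq.2 : Quaternion ℝ)⁻¹ * (s : Quaternion ℝ)) = 1} ⊓
            Filter.comap
              (fun pq : O' × O' => Quaternion.normSq ((pq.2 : Quaternion ℝ)))
              Filter.atTop) ≤ C := by
  obtain ⟨b, hO⟩ := exists_basis_of_order A hAdim hAspan O' hO'A hO'fg hO'span
  obtain ⟨m, hm, hmI⟩ := exists_natCast_mem_ideal hO hI'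
  obtain ⟨C, hC, happrox⟩ := exists_unimodular_approx hO hO'A (m := 5 * m) (by omega)
  refine ⟨C, hC, fun x hx => ?_⟩
  rw [Filter.liminf_eq]
  refine Real.sSup_le (fun a ha => ?_) hC.le
  rw [Set.mem_ofPred_eq, inf_comm, Filter.eventually_inf_principal, Filter.eventually_comap,
    Filter.eventually_atTop] at ha
  obtain ⟨K, hK⟩ := ha
  obtain ⟨p, hp, y, hy, q, hqy, hq, hle, r, hr, s, hs, hrs⟩ := happrox x hx (max K 1)
  have hqO : q ∈ O' := hqy ▸ O'.mul_mem (natCast_mem O' _) hy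
  have hqI : (⟨q, hqO⟩ : O') ∈ I' := by
    have : (⟨q, hqO⟩ : O') = 5 * (m * ⟨y, hy⟩) := by
      apply Subtype.ext
      rw [← mul_assoc]
      have h5 : ((5 : O') : Quaternion ℝ) = 5 := rfl
      simpa [h5] using hqy
    rw [this]
    exact I'.mul_mem_left _ _ (I'.mul_mem_right _ _ hmI)
  have h1 : 1 < ‖q‖ := (le_max_right _ _).trans_lt hq
  have hKq : K ≤ Quaternion.normSq q := by
    rw [Quaternion.normSq_eq_norm_mul_self]
    nlinarith [(le_max_left K 1).trans_lt hq]
  have := hK _ hKq (⟨p, hp⟩, ⟨q, hqO⟩) rfl ⟨hqI, ⟨r, hr⟩, ⟨s, hs⟩, hrs⟩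
  refine this.trans (le_of_eq_of_le ?_ hle)
  have hq0 : q ≠ 0 := norm_pos_iff.1 (by linarith)
  change Quaternion.normSq q * √(Quaternion.normSq (x - p * q⁻¹)) = _
  rw [Quaternion.normSq_eq_norm_mul_self, Quaternion.normSq_eq_norm_mul_self,
    Real.sqrt_mul_self (norm_nonneg _),
    ← norm_sub_mul_inv_mul x p hq0]
  ring
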